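/- Constantin–E–Titi commutator identity: for f, g ∈ L²_loc(R^d) and a mollifier η_ε supported in B_ε(0), the pointwise identity (fg)^ε(x) − f^ε(x)g^ε(x) = ∫_{B_ε(0)} η_ε(y)[f(x−y)−f(x)][g(x−y)−g(x)] dy − (f−f^ε)(x)(g−g^ε)(x) holds for a.e. x. -/

import Mathlib

open MeasureTheory ENNReal

noncomputable section

/-- Vectors in ℝ^d. -/
abbrev Vec (d : ℕ) := Fin d → ℝ

/-- Lebesgue measure restricted to a fundamental domain of the torus T^d = ℝ^d/ℤ^d. -/
def torusMeasure (d : ℕ) : Measure (Vec d) := volume.restrict (Set.Icc (0 : Vec d) 1)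

/-- ℤ^d-periodicity: a function on ℝ^d descending to the torus T^d. -/
def PeriodicZ {d : ℕ} (f : Vec d → ℝ) : Prop :=
  ∀ (x : Vec d) (n : Fin d → ℤ), f (x + fun i => (n i : ℝ)) = f x

/-- A standard mollifier: smooth, nonnegative, supported in the unit ball,
    with total mass one. -/
def IsMollifier {d : ℕ} (η : Vec d → ℝ) : Prop :=
  ContDiff ℝ (⊤ : ℕ∞) η ∧ (∀ x, 0 ≤ η x) ∧ (∀ x : Vec d, 1 ≤ ‖x‖ → η x = 0) ∧ (∫ x, η x) = 1

/-- The rescaled mollifier η_ε(x) = ε^{-d} η(x/ε). -/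
def mollAt {d : ℕ} (η : Vec d → ℝ) (ε : ℝ) (x : Vec d) : ℝ :=
  ε ^ (-(d : ℤ)) * η (ε⁻¹ • x)

/-- The mollification f^ε = f * η_ε. -/
def mollify {d : ℕ} (η : Vec d → ℝ) (ε : ℝ) (f : Vec d → ℝ) (x : Vec d) : ℝ :=
  ∫ y, mollAt η ε y * f (x - y)

lemma LocallyIntegrable.of_sq {X : Type*} [TopologicalSpace X] [MeasurableSpace X]
    {μ : Measure X} [IsLocallyFiniteMeasure μ] {f : X → ℝ} (hfm : AEStronglyMeasurable f μ)
    (hf : LocallyIntegrable (fun x => f x ^ 2) μ) : LocallyIntegrable f μ := by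
  refine ((locallyIntegrable_const (1 : ℝ)).add hf).mono hfm (ae_of_all _ fun x => ?_)
  simp only [Pi.add_apply, Real.norm_eq_abs]
  rw [abs_of_nonneg (a := 1 + f x ^ 2) (by positivity), ← sq_abs]
  nlinarith [sq_nonneg (|f x| - 1), abs_nonneg (f x)]

lemma LocallyIntegrable.mul_of_sq {X : Type*} [TopologicalSpace X] [MeasurableSpace X]
    {μ : Measure X} {f g : X → ℝ}
    (hfm : AEStronglyMeasurable f μ) (hgm : AEStronglyMeasurable g μ)
    (hf : LocallyIntegrable (fun x => f x ^ 2) μ)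
    (hg : LocallyIntegrable (fun x => g x ^ 2) μ) :
    LocallyIntegrable (fun x => f x * g x) μ := by
  refine (hf.add hg).mono (hfm.mul hgm) (ae_of_all _ fun x => ?_)
  simp only [Pi.add_apply, Real.norm_eq_abs]
  rw [abs_of_nonneg (a := f x ^ 2 + g x ^ 2) (by positivity), abs_le]
  constructor <;> nlinarith [sq_nonneg (f x - g x), sq_nonneg (f x + g x)]

lemma mollAt_eq_zero {d : ℕ} {η : Vec d → ℝ} (hη : IsMollifier η) {ε : ℝ} (hε : 0 < ε)
    {y : Vec d} (hy : ε ≤ ‖y‖) : mollAt η ε y = 0 := by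
  have h : 1 ≤ ‖ε⁻¹ • y‖ := by
    rw [norm_smul, norm_inv, Real.norm_of_nonneg hε.le, inv_mul_eq_div]
    exact (one_le_div hε).2 hy
  rw [mollAt, hη.2.2.1 _ h, mul_zero]

lemma continuous_mollAt {d : ℕ} {η : Vec d → ℝ} (hη : IsMollifier η) (ε : ℝ) :
    Continuous (mollAt η ε) :=
  continuous_const.mul (hη.1.continuous.comp (continuous_const_smul _))

lemma hasCompactSupport_mollAt {d : ℕ} {η : Vec d → ℝ} (hη : IsMollifier η) {ε : ℝ}
    (hε : 0 < ε) : HasCompactSupport (mollAt η ε) := by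
  refine HasCompactSupport.intro (isCompact_closedBall (0 : Vec d) ε) fun y hy => ?_
  rw [mem_closedBall_zero_iff, not_le] at hy
  exact mollAt_eq_zero hη hε hy.le

lemma integral_mollAt {d : ℕ} {η : Vec d → ℝ} (hη : IsMollifier η) {ε : ℝ} (hε : 0 < ε) :
    ∫ y, mollAt η ε y = 1 := by
  simp only [mollAt]
  rw [integral_const_mul, Measure.integral_comp_inv_smul, hη.2.2.2, Module.finrank_fin_fun,
    abs_of_pos (by positivity), smul_eq_mul, mul_one, zpow_neg, zpow_natCast]
  exact inv_mul_cancel₀ (by positivity)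

lemma integrable_mollAt_mul {d : ℕ} {η : Vec d → ℝ} (hη : IsMollifier η) {ε : ℝ} (hε : 0 < ε)
    {f : Vec d → ℝ} (hf : LocallyIntegrable f volume) (x : Vec d) :
    Integrable (fun y => mollAt η ε y * f (x - y)) volume :=
  (hasCompactSupport_mollAt hη hε).convolutionExists_left (ContinuousLinearMap.mul ℝ ℝ)
    (continuous_mollAt hη ε) hf x

/-- Constantin–E–Titi commutator identity: for f, g ∈ L²_loc(ℝ^d) and a mollifier
    η_ε supported in B_ε(0),
    (fg)^ε − f^ε g^ε
      = ∫_{B_ε(0)} η_ε(y)[f(x−y)−f(x)][g(x−y)−g(x)] dy − (f−f^ε)(x)(g−g^ε)(x)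
    for a.e. x. -/
theorem constantin_e_titi_identity (d : ℕ) (η : Vec d → ℝ) (hη : IsMollifier η)
    (f g : Vec d → ℝ)
    (hfm : AEStronglyMeasurable f (volume : Measure (Vec d)))
    (hgm : AEStronglyMeasurable g (volume : Measure (Vec d)))
    (hf : LocallyIntegrable (fun x => f x ^ 2) (volume : Measure (Vec d)))
    (hg : LocallyIntegrable (fun x => g x ^ 2) (volume : Measure (Vec d)))
    (ε : ℝ) (hε : 0 < ε) :
    ∀ᵐ x : Vec d, mollify η ε (fun z => f z * g z) x - mollify η ε f x * mollify η ε g x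
      = (∫ y in Metric.ball (0 : Vec d) ε,
          mollAt η ε y * ((f (x - y) - f x) * (g (x - y) - g x)))
        - (f x - mollify η ε f x) * (g x - mollify η ε g x) := by
  refine ae_of_all _ fun x => ?_
  have hF := integrable_mollAt_mul hη hε (LocallyIntegrable.of_sq hfm hf) x
  have hG := integrable_mollAt_mul hη hε (LocallyIntegrable.of_sq hgm hg) x
  have hFG := integrable_mollAt_mul hη hε (LocallyIntegrable.mul_of_sq hfm hgm hf hg) x
  have hM : Integrable (mollAt η ε) volume :=
    (continuous_mollAt hη ε).integrable_of_hasCompactSupport (hasCompactSupport_mollAt hη hε)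
  have hball : (∫ y in Metric.ball (0 : Vec d) ε,
        mollAt η ε y * ((f (x - y) - f x) * (g (x - y) - g x)))
      = ∫ y, mollAt η ε y * ((f (x - y) - f x) * (g (x - y) - g x)) := by
    refine setIntegral_eq_integral_of_forall_compl_eq_zero fun y hy => ?_
    rw [mem_ball_zero_iff, not_lt] at hy
    rw [mollAt_eq_zero hη hε hy, zero_mul]
  have hexpand : (∫ y, mollAt η ε y * ((f (x - y) - f x) * (g (x - y) - g x)))
      = mollify η ε (fun z => f z * g z) x - mollify η ε f x * g x - mollify η ε g x * f x
        + f x * g x := by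
    calc _ = ∫ y, (mollAt η ε y * (f (x - y) * g (x - y)) - mollAt η ε y * f (x - y) * g x
          - mollAt η ε y * g (x - y) * f x + mollAt η ε y * (f x * g x)) := by
          congr 1 with y
          ring
      _ = _ := by
          have hFg := hF.mul_const (g x)
          have hGf := hG.mul_const (f x)
          have h₁ : Integrable (fun y => mollAt η ε y * (f (x - y) * g (x - y))
              - mollAt η ε y * f (x - y) * g x) volume := hFG.sub hFg
          have h₂ : Integrable (fun y => mollAt η ε y * (f (x - y) * g (x - y))
              - mollAt η ε y * f (x - y) * g x - mollAt η ε y * g (x - y) * f x) volume :=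
            h₁.sub hGf
          rw [integral_add h₂ (hM.mul_const _), integral_sub h₁ hGf, integral_sub hFG hFg,
            integral_mul_const, integral_mul_const,
            integral_mul_const, integral_mollAt hη hε, one_mul]
          rfl
  rw [hball, hexpand]
  ring
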